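/- For real coefficients α₁,…,α₆, β₁, β₂, β₃, the quadratic combination W = α₁L² + α₂LM₁ + α₃LM₂ + α₄M₁² + α₅M₁M₂ + α₆M₂² + β₁M₁R₂ + β₂M₂R₁ + β₃M₂R₂ of the S-Heun operators on the discrete linear grid equals the operator 𝒜₁T₊² + 𝒜₀I + 𝒜₂T₋² (where T₊², T₋² shift the argument by ±2), with 𝒜₁(x) = ¼[−2β₂x³ + (α₆−3β₂+β₃)x² + (α₃+α₅+α₆+β₁−β₂+β₃)x + (α₁+α₂+α₃+α₄+α₅+β₁)], 𝒜₂(x) = ¼[−2β₂x³ + (α₆+3β₂−β₃)x² + (α₃−α₅−α₆+β₁−β₂+β₃)x + (α₁−α₂−α₃+α₄+α₅−β₁)], and 𝒜₀(x) = (β₁+β₂+β₃)x + α₄ − (𝒜₁(x)+𝒜₂(x)). Conversely, every operator 𝒜₁T₊² + 𝒜₀I + 𝒜₂T₋² in which 𝒜₁, 𝒜₂ are polynomials of degree at most 3 with equal x³-coefficients and 𝒜₀ + 𝒜₁ + 𝒜₂ is a polynomial of degree at most 1 arises from such a quadratic combination. Hence the generic Heun–Continuous Hahn operator is exactly the most general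 quadratic combination of the discrete-grid S-Heun operators that does not raise the degree of polynomials by more than one. -/

import Mathlib

open Polynomial

/-- Lowering S-Heun operator `L = ½(T₊ − T₋)` on the discrete linear grid. -/
noncomputable def opL (f : ℝ → ℝ) : ℝ → ℝ := fun x => (f (x+1) - f (x-1)) / 2
/-- Stabilizing S-Heun operator `M₁ = ½(T₊ + T₋)`. -/
noncomputable def opM1 (f : ℝ → ℝ) : ℝ → ℝ := fun x => (f (x+1) + f (x-1)) / 2
/-- Stabilizing S-Heun operator `M₂ = ½ x (T₊ − T₋)`. -/
noncomputable def opM2 (f : ℝ → ℝ) : ℝ → ℝ := fun x => x * (f (x+1) - f (x-1)) / 2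
/-- Raising S-Heun operator `R₁ = ½ x [(1−2x)T₊ + (1+2x)T₋]`. -/
noncomputable def opR1 (f : ℝ → ℝ) : ℝ → ℝ :=
  fun x => x * ((1 - 2*x) * f (x+1) + (1 + 2*x) * f (x-1)) / 2
/-- Raising S-Heun operator `R₂ = ½ x (T₊ + T₋)`. -/
noncomputable def opR2 (f : ℝ → ℝ) : ℝ → ℝ := fun x => x * (f (x+1) + f (x-1)) / 2

/-- Coefficient `𝒜₁` of the Heun–Continuous Hahn operator. -/
noncomputable def chA1 (α₁ α₂ α₃ α₄ α₅ α₆ β₁ β₂ β₃ : ℝ) (x : ℝ) : ℝ :=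
  (1/4) * (-2*β₂*x^3 + (α₆ - 3*β₂ + β₃)*x^2
    + (α₃ + α₅ + α₆ + β₁ - β₂ + β₃)*x
    + (α₁ + α₂ + α₃ + α₄ + α₅ + β₁))

/-- Coefficient `𝒜₂` of the Heun–Continuous Hahn operator. -/
noncomputable def chA2 (α₁ α₂ α₃ α₄ α₅ α₆ β₁ β₂ β₃ : ℝ) (x : ℝ) : ℝ :=
  (1/4) * (-2*β₂*x^3 + (α₆ + 3*β₂ - β₃)*x^2
    + (α₃ - α₅ - α₆ + β₁ - β₂ + β₃)*x
    + (α₁ - α₂ - α₃ + α₄ + α₅ - β₁))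

/-- The general quadratic combination
`W = α₁L² + α₂LM₁ + α₃LM₂ + α₄M₁² + α₅M₁M₂ + α₆M₂² + β₁M₁R₂ + β₂M₂R₁ + β₃M₂R₂`. -/
noncomputable def chW (α₁ α₂ α₃ α₄ α₅ α₆ β₁ β₂ β₃ : ℝ) (f : ℝ → ℝ) : ℝ → ℝ := fun x =>
  α₁ * opL (opL f) x + α₂ * opL (opM1 f) x + α₃ * opL (opM2 f) x
  + α₄ * opM1 (opM1 f) x + α₅ * opM1 (opM2 f) x + α₆ * opM2 (opM2 f) x
  + β₁ * opM1 (opR2 f) x + β₂ * opM2 (opR1 f) x + β₃ * opM2 (opR2 f) x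

/-- The generic Heun–Continuous Hahn operator `𝒜₁T₊² + 𝒜₀I + 𝒜₂T₋²` is exactly the most
general quadratic combination of the discrete-grid S-Heun operators that does not raise
the degree of polynomials by more than one. -/
theorem stmt_15 :
    (∀ α₁ α₂ α₃ α₄ α₅ α₆ β₁ β₂ β₃ : ℝ, ∀ (f : ℝ → ℝ) (x : ℝ),
      chW α₁ α₂ α₃ α₄ α₅ α₆ β₁ β₂ β₃ f x
        = chA1 α₁ α₂ α₃ α₄ α₅ α₆ β₁ β₂ β₃ x * f (x+2)
          + ((β₁ + β₂ + β₃)*x + α₄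
              - (chA1 α₁ α₂ α₃ α₄ α₅ α₆ β₁ β₂ β₃ x
                 + chA2 α₁ α₂ α₃ α₄ α₅ α₆ β₁ β₂ β₃ x)) * f x
          + chA2 α₁ α₂ α₃ α₄ α₅ α₆ β₁ β₂ β₃ x * f (x-2)) ∧
    (∀ (p₁ p₂ π₁ : ℝ[X]), p₁.degree ≤ (3 : ℕ) → p₂.degree ≤ (3 : ℕ) →
      p₁.coeff 3 = p₂.coeff 3 → π₁.degree ≤ (1 : ℕ) →
      ∃ α₁ α₂ α₃ α₄ α₅ α₆ β₁ β₂ β₃ : ℝ, ∀ (f : ℝ → ℝ) (x : ℝ),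
        chW α₁ α₂ α₃ α₄ α₅ α₆ β₁ β₂ β₃ f x
          = p₁.eval x * f (x+2)
            + (π₁.eval x - p₁.eval x - p₂.eval x) * f x
            + p₂.eval x * f (x-2)) := by
  have h1 : ∀ α₁ α₂ α₃ α₄ α₅ α₆ β₁ β₂ β₃ : ℝ, ∀ (f : ℝ → ℝ) (x : ℝ),
      chW α₁ α₂ α₃ α₄ α₅ α₆ β₁ β₂ β₃ f x
        = chA1 α₁ α₂ α₃ α₄ α₅ α₆ β₁ β₂ β₃ x * f (x+2)
          + ((β₁ + β₂ + β₃)*x + α₄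
              - (chA1 α₁ α₂ α₃ α₄ α₅ α₆ β₁ β₂ β₃ x
                 + chA2 α₁ α₂ α₃ α₄ α₅ α₆ β₁ β₂ β₃ x)) * f x
          + chA2 α₁ α₂ α₃ α₄ α₅ α₆ β₁ β₂ β₃ x * f (x-2) := by
    intro α₁ α₂ α₃ α₄ α₅ α₆ β₁ β₂ β₃ f x
    have e1 : x + 1 + 1 = x + 2 := by ring
    have e2 : x + 1 - 1 = x := by ring
    have e3 : x - 1 + 1 = x := by ring
    have e4 : x - 1 - 1 = x - 2 := by ring
    simp only [chW, chA1, chA2, opL, opM1, opM2, opR1, opR2, e1, e2, e3, e4]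
    ring
  refine ⟨h1, ?_⟩
  intro p q r hp hq h3 hr
  have ep : ∀ x, p.eval x = p.coeff 0 + p.coeff 1 * x + p.coeff 2 * x^2 + p.coeff 3 * x^3 := by
    intro x
    rw [eval_eq_sum_range' (n := 4)
      (Nat.lt_succ_of_le (natDegree_le_of_degree_le hp)) x]
    simp [Finset.sum_range_succ]
  have eq : ∀ x, q.eval x = q.coeff 0 + q.coeff 1 * x + q.coeff 2 * x^2 + p.coeff 3 * x^3 := by
    intro x
    rw [h3, eval_eq_sum_range' (n := 4)
      (Nat.lt_succ_of_le (natDegree_le_of_degree_le hq)) x]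
    simp [Finset.sum_range_succ]
  have er : ∀ x, r.eval x = r.coeff 0 + r.coeff 1 * x := by
    intro x
    rw [eval_eq_sum_range' (n := 2)
      (Nat.lt_succ_of_le (natDegree_le_of_degree_le hr)) x]
    simp [Finset.sum_range_succ]
  obtain ⟨β₂, hβ₂⟩ : ∃ t, t = -2 * p.coeff 3 := ⟨_, rfl⟩
  obtain ⟨α₆, hα₆⟩ : ∃ t, t = 2 * (p.coeff 2 + q.coeff 2) := ⟨_, rfl⟩
  obtain ⟨β₃, hβ₃⟩ : ∃ t, t = 2 * (p.coeff 2 - q.coeff 2) + 3 * β₂ := ⟨_, rfl⟩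
  obtain ⟨β₁, hβ₁⟩ : ∃ t, t = r.coeff 1 - β₂ - β₃ := ⟨_, rfl⟩
  obtain ⟨α₃, hα₃⟩ : ∃ t, t = 2 * (p.coeff 1 + q.coeff 1) - β₁ + β₂ - β₃ := ⟨_, rfl⟩
  obtain ⟨α₅, hα₅⟩ : ∃ t, t = 2 * (p.coeff 1 - q.coeff 1) - α₆ := ⟨_, rfl⟩
  refine ⟨2 * (p.coeff 0 + q.coeff 0) - r.coeff 0 - α₅, 2 * (p.coeff 0 - q.coeff 0) - α₃ - β₁,
    α₃, r.coeff 0, α₅, α₆, β₁, β₂, β₃, ?_⟩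
  intro f x
  rw [h1, ep, eq, er]
  simp only [chA1, chA2]
  subst hα₅ hα₃ hβ₁ hβ₃ hα₆ hβ₂
  ring
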